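/- arXiv:1609.06777 — 9 statements merged into one kernel-verified Lean document; each statement's English description precedes it below -/
import Mathlib

section
/- For all integers n ≥ 1 and m ≥ 2, the Hamming graph K_m^n contains a subgraph isomorphic to the Sierpinski graph S(n,m); precisely, there exists an injective map f : {0,1,...,m−1}^n → {0,1,...,m−1}^n such that whenever u and v are adjacent in S(n,m), the tuples f(u) and f(v) differ in exactly one coordinate. -/
/-- Adjacency in the (generalized & expanded) Sierpinski graph `S(n,m)`:
distinct vertices `u v : Fin n → Fin m` are adjacent iff there is a coordinate `h`
with `u i = v i` for `i < h`, `u h ≠ v h`, and `u j = v h`, `v j = u h` for `j > h`. -/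
def sierpAdj {n m : ℕ} (u v : Fin n → Fin m) : Prop :=
  ∃ h : Fin n, (∀ i, i < h → u i = v i) ∧ u h ≠ v h ∧ ∀ j, h < j → u j = v h ∧ v j = u h

/-- The unitriangular endomorphism `y ↦ (i ↦ y i - ∑ j < i, y j)` of `Fin n → A`. It sends the
one-coordinate vector `Pi.single h c` to the difference of the ends of a Sierpinski edge. -/
def subPrefixSum (n : ℕ) (A : Type*) [AddCommGroup A] : (Fin n → A) →+ (Fin n → A) where
  toFun y i := y i - ∑ j ∈ Finset.Iio i, y j
  map_zero' := by ext; simp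
  map_add' x y := by
    ext i
    simp only [Pi.add_apply, Finset.sum_add_distrib]
    abel

theorem subPrefixSum_apply {n : ℕ} {A : Type*} [AddCommGroup A] (y : Fin n → A) (i : Fin n) :
    subPrefixSum n A y i = y i - ∑ j ∈ Finset.Iio i, y j := rfl

theorem subPrefixSum_injective (n : ℕ) (A : Type*) [AddCommGroup A] :
    Function.Injective (subPrefixSum n A) := by
  rw [injective_iff_map_eq_zero]
  intro y hy
  ext i
  induction i using WellFoundedLT.induction with
  | ind i ih =>
    have hi := congrFun hy i
    rwa [subPrefixSum_apply, Finset.sum_eq_zero fun j hj => ih j (Finset.mem_Iio.mp hj),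
      sub_zero] at hi

theorem subPrefixSum_single {n : ℕ} {A : Type*} [AddCommGroup A] (h : Fin n) (c : A) (i : Fin n) :
    subPrefixSum n A (Pi.single h c) i = if i < h then 0 else if i = h then c else -c := by
  rw [subPrefixSum_apply, Finset.sum_pi_single']
  rcases lt_trichotomy i h with hi | rfl | hi
  · simp [hi, hi.ne, hi.le]
  · simp
  · simp [hi, hi.ne', hi.le]

/-- For all `n ≥ 1`, `m ≥ 2`, there is an injective map
`f : {0,…,m−1}ⁿ → {0,…,m−1}ⁿ` sending each edge of `S(n,m)` to a pair of tuples
differing in exactly one coordinate, i.e. `S(n,m)` embeds in the Hamming graph `K_mⁿ`. -/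
theorem sierpinski_embeds_in_hamming (n m : ℕ) (hn : 1 ≤ n) (hm : 2 ≤ m) :
    ∃ f : (Fin n → Fin m) → (Fin n → Fin m),
      Function.Injective f ∧
      ∀ u v : Fin n → Fin m, sierpAdj u v → (∃! i : Fin n, f u i ≠ f v i) := by
  have : NeZero m := ⟨by omega⟩
  obtain ⟨f, -, hf⟩ := Function.bijective_iff_has_inverse.mp
    (Finite.injective_iff_bijective.mp (subPrefixSum_injective n (Fin m)))
  refine ⟨f, hf.injective, ?_⟩
  rintro u v ⟨h, hlt, hne, hgt⟩
  have key : f u = f v + Pi.single h (u h - v h) := by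
    apply subPrefixSum_injective n (Fin m)
    rw [map_add, hf u, hf v]
    ext1 i
    rw [Pi.add_apply, subPrefixSum_single]
    rcases lt_trichotomy i h with hi | rfl | hi
    · simp [hi, hlt i hi]
    · simp
    · simp [hi.not_gt, hi.ne', hgt i hi]
  refine ⟨h, by simpa [key, sub_eq_zero] using hne, fun i hi => ?_⟩
  by_contra hih
  exact hi (by simp [key, hih])
end

section
/- For all integers n ≥ 1 and m ≥ 2, the map φ : (Z/mZ)^n → (Z/mZ)^n defined by φ(v)_i = v_i + Σ_{j=1}^{i−1} 2^{i−1−j} v_j is injective and sends every edge of the Sierpinski graph S(n,m) to a pair of tuples differing in exactly one coordinate; i.e., φ is a graph embedding of S(n,m) into the Hamming graph K_m^n. -/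
/-- Adjacency in the Sierpinski graph `S(n,m)`, with vertex set `(ZMod m)ⁿ`. -/
def sierpAdjZ {n m : ℕ} (u v : Fin n → ZMod m) : Prop :=
  ∃ h : Fin n, (∀ i, i < h → u i = v i) ∧ u h ≠ v h ∧ ∀ j, h < j → u j = v h ∧ v j = u h

/-- The embedding map `φ(v)_i = v_i + Σ_{j=1}^{i−1} 2^{i−1−j} v_j`
(here coordinates are 0-indexed, so the exponent `i−1−j` becomes `i−j−1`). -/
def sierpPhi {n m : ℕ} (v : Fin n → ZMod m) : Fin n → ZMod m :=
  fun i => v i + ∑ j ∈ Finset.univ.filter (· < i), (2 : ZMod m) ^ (i.val - j.val - 1) * v j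

/-- The map `sierpPhi` is compatible with subtraction. -/
theorem sierpPhi_sub {n m : ℕ} (u v : Fin n → ZMod m) :
    sierpPhi (u - v) = sierpPhi u - sierpPhi v := by
  funext i
  simp only [sierpPhi, Pi.sub_apply, mul_sub, Finset.sum_sub_distrib]
  ring

theorem sierpPhi_eq_of_forall_lt_eq_zero {n m : ℕ} {d : Fin n → ZMod m} {i : Fin n}
    (hd : ∀ j < i, d j = 0) : sierpPhi d i = d i := by
  rw [sierpPhi, Finset.sum_eq_zero, add_zero]
  intro j hj
  rw [hd j (Finset.mem_filter.mp hj).2, mul_zero]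

theorem sierpPhi_injective (n m : ℕ) : Function.Injective (sierpPhi (n := n) (m := m)) := by
  intro u v huv
  have hzero : sierpPhi (u - v) = 0 := by rw [sierpPhi_sub, huv, sub_self]
  rw [← sub_eq_zero]
  funext i
  induction i using WellFoundedLT.induction with
  | ind i ih => rw [← sierpPhi_eq_of_forall_lt_eq_zero ih, hzero]

/-- If `d` vanishes before `h` and equals `-d h` after `h`, then all its weighted partial sums
past `h` equal `d h`. -/
theorem sum_two_pow_mul_eq {R : Type*} [CommRing R] {n : ℕ} {d : Fin n → R} {h : Fin n}
    (hlt : ∀ j < h, d j = 0) (hgt : ∀ j, h < j → d j = -d h) {k : ℕ} (hk : h.val + 1 ≤ k)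
    (hkn : k ≤ n) :
    ∑ j : Fin n with j.val < k, (2 : R) ^ (k - j.val - 1) * d j = d h := by
  induction k, hk using Nat.le_induction with
  | base =>
    rw [Finset.sum_eq_single h]
    · simp
    · intro j hj hne
      have hj' : j.val < h.val + 1 := (Finset.mem_filter.mp hj).2
      rw [hlt j (lt_of_le_of_ne (Nat.lt_succ_iff.mp hj') hne), mul_zero]
    · simp
  | succ k hk ih =>
    have hins : (Finset.univ.filter fun j : Fin n => j.val < k + 1) =
        insert ⟨k, hkn⟩ (Finset.univ.filter fun j : Fin n => j.val < k) := by
      ext j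
      simp only [Finset.mem_filter, Finset.mem_univ, true_and, Finset.mem_insert, Fin.ext_iff]
      omega
    have hdouble : ∑ j : Fin n with j.val < k, (2 : R) ^ (k + 1 - j.val - 1) * d j =
        2 * ∑ j : Fin n with j.val < k, (2 : R) ^ (k - j.val - 1) * d j := by
      rw [Finset.mul_sum]
      refine Finset.sum_congr rfl fun j hj => ?_
      have hj' : j.val < k := (Finset.mem_filter.mp hj).2
      rw [show k + 1 - j.val - 1 = (k - j.val - 1) + 1 by omega, pow_succ]
      ring
    rw [hins, Finset.sum_insert (by simp), hdouble, ih (by omega),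
      hgt ⟨k, hkn⟩ (Fin.lt_def.mpr hk)]
    simp only [add_tsub_cancel_left, tsub_self, pow_zero]
    ring

/-- for `n ≥ 1`, `m ≥ 2`, the map `φ` is injective and sends every edge
of `S(n,m)` to a pair of tuples differing in exactly one coordinate, i.e. `φ` is a
graph embedding of `S(n,m)` into the Hamming graph `K_mⁿ`. -/
theorem sierpPhi_embedding (n m : ℕ) (hn : 1 ≤ n) (hm : 2 ≤ m) :
    Function.Injective (sierpPhi (n := n) (m := m)) ∧
    ∀ u v : Fin n → ZMod m, sierpAdjZ u v →
      (∃! i : Fin n, sierpPhi u i ≠ sierpPhi v i) := by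
  refine ⟨sierpPhi_injective n m, ?_⟩
  rintro u v ⟨h, hlt, hne, hgt⟩
  have hd_lt : ∀ j < h, (u - v) j = 0 := fun j hj => sub_eq_zero.mpr (hlt j hj)
  have hd_gt : ∀ j, h < j → (u - v) j = -(u - v) h := fun j hj => by
    simp [(hgt j hj).1, (hgt j hj).2]
  have hiff : ∀ i, sierpPhi u i ≠ sierpPhi v i ↔ sierpPhi (u - v) i ≠ 0 := fun i => by
    rw [sierpPhi_sub, Pi.sub_apply, sub_ne_zero]
  simp only [hiff]
  refine ⟨h, ?_, fun i hi => ?_⟩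
  · simpa only [sierpPhi_eq_of_forall_lt_eq_zero hd_lt, Pi.sub_apply] using sub_ne_zero.mpr hne
  · by_contra hih
    refine hi ?_
    rcases lt_or_gt_of_ne hih with hih | hih
    · rw [sierpPhi_eq_of_forall_lt_eq_zero fun j hj => hd_lt j (hj.trans hih), hd_lt i hih]
    · have hsum := sum_two_pow_mul_eq hd_lt hd_gt (Nat.succ_le_of_lt hih) i.isLt.le
      simp only [sierpPhi, Fin.lt_def]
      rw [hsum, hd_gt i hih, neg_add_cancel]
end

section
/- For every integer m ≥ 2, the map ψ(v_1, v_2) = (v_1, (v_1 + v_2) mod m) is a graph isomorphism from the Sierpinski graph S(2,m) onto the graph S̃(2,m): it is a bijection of {0,1,...,m−1}^2 and u, v are adjacent in S(2,m) if and only if ψ(u), ψ(v) are adjacent in S̃(2,m). -/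
/-- Adjacency in the twisted graph `S̃(n,m)`: `u` and `v` are adjacent iff there is `h`
with `u_l = v_l` for all `l ≠ h`, `u_h ≠ v_h`, and `u_l = v_l = (u_h + v_h) mod m` for
all `l > h`  (addition in `Fin m` is addition mod `m`). -/
def tildeAdj {n m : ℕ} [NeZero m] (u v : Fin n → Fin m) : Prop :=
  ∃ h : Fin n, (∀ l, l ≠ h → u l = v l) ∧ u h ≠ v h ∧
    ∀ l, h < l → u l = u h + v h ∧ v l = u h + v h

/-- for every `m ≥ 2`, the map `ψ(v₁,v₂) = (v₁, (v₁+v₂) mod m)` is a graph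
isomorphism from `S(2,m)` onto `S̃(2,m)`. -/
theorem sierp_two_iso_tilde (m : ℕ) [NeZero m] (hm : 2 ≤ m) :
    Function.Bijective (fun v : Fin 2 → Fin m => ![v 0, v 0 + v 1]) ∧
    ∀ u v : Fin 2 → Fin m,
      sierpAdj u v ↔ tildeAdj ![u 0, u 0 + u 1] ![v 0, v 0 + v 1] := by
  refine ⟨⟨fun u v h => ?_, fun w => ⟨![w 0, w 1 - w 0], ?_⟩⟩, fun u v => ?_⟩
  · have h0 : u 0 = v 0 := congrFun h 0
    have h1 : u 0 + u 1 = v 0 + v 1 := congrFun h 1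
    rw [h0, add_right_inj] at h1
    ext i
    fin_cases i <;> simp [h0, h1]
  · ext i
    fin_cases i <;> simp
  · simp only [sierpAdj, tildeAdj, Fin.exists_fin_two, Fin.forall_fin_two, Matrix.cons_val_zero,
      Matrix.cons_val_one]
    have hcomm : v 0 + v 1 = u 0 + v 0 ↔ v 1 = u 0 := by rw [add_comm (u 0), add_right_inj]
    simp only [add_right_inj, hcomm]
    constructor
    · rintro (⟨-, hne, h⟩ | ⟨h, hne, -⟩)
      · obtain ⟨h1, h2⟩ := h.2 Fin.zero_lt_one
        left
        simp [hne, h1, h2, add_comm]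
      · right
        have h0 := h.1 Fin.zero_lt_one
        simp [h0, hne]
    · rintro (⟨-, hne, h⟩ | ⟨h, hne, -⟩)
      · left
        simp [hne, h.2 Fin.zero_lt_one]
      · right
        have h0 := h.1 Fin.zero_ne_one
        rw [h0, ne_eq, add_right_inj] at hne
        simp [h0, hne]
end

section
/- For every integer n ≥ 1, the map τ : (Z/3Z)^n → (Z/3Z)^n defined by τ(v)_i = 2^{i−1}·(v_i + Σ_{j=1}^{i−1} 2^{i−1−j} v_j) is injective, sends every edge of the Sierpinski graph S(n,3) to a pair of tuples differing in exactly one coordinate, and fixes every constant vertex: τ(i,i,...,i) = (i,i,...,i) for each i ∈ Z/3Z. -/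
/-- The Tower-of-Hanoi embedding map
`τ(v)_i = 2^{i−1}·(v_i + Σ_{j=1}^{i−1} 2^{i−1−j} v_j)` (0-indexed coordinates). -/
def hanoiTau {n : ℕ} (v : Fin n → ZMod 3) : Fin n → ZMod 3 :=
  fun i => (2 : ZMod 3) ^ i.val *
    (v i + ∑ j ∈ Finset.univ.filter (· < i), (2 : ZMod 3) ^ (i.val - j.val - 1) * v j)

/-- The weighted partial sums `∑_{j<k} 2^{k-1-j} w_j` modulo 3, for a sequence on `ℕ`. -/
def weightedSum (w : ℕ → ZMod 3) (k : ℕ) : ZMod 3 :=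
  ∑ j ∈ Finset.range k, (2 : ZMod 3) ^ (k - j - 1) * w j

lemma weightedSum_zero (w : ℕ → ZMod 3) : weightedSum w 0 = 0 := by
  simp [weightedSum]

lemma weightedSum_succ (w : ℕ → ZMod 3) (k : ℕ) :
    weightedSum w (k + 1) = 2 * weightedSum w k + w k := by
  unfold weightedSum
  rw [Finset.sum_range_succ, Finset.mul_sum]
  congr 1
  · refine Finset.sum_congr rfl fun j hj => ?_
    have hj' := Finset.mem_range.mp hj
    rw [show k + 1 - j - 1 = (k - j - 1) + 1 by omega, pow_succ]
    ring
  · simp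

lemma hanoiTau_apply_nat {n : ℕ} (w : ℕ → ZMod 3) (i : Fin n) :
    hanoiTau (fun j : Fin n => w j) i = 2 ^ i.val * (w i + weightedSum w i) := by
  unfold hanoiTau weightedSum
  congr 2
  refine Finset.sum_bij (fun j _ => j.val) ?_ ?_ ?_ ?_
  · intro j hj
    exact Finset.mem_range.mpr (Finset.mem_filter.mp hj).2
  · intro a _ b _ hab
    exact Fin.ext hab
  · intro b hb
    have hb' := Finset.mem_range.mp hb
    exact ⟨⟨b, hb'.trans i.isLt⟩, Finset.mem_filter.mpr ⟨Finset.mem_univ _, hb'⟩, rfl⟩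
  · intro j _
    rfl

lemma exists_nat_extension {n : ℕ} (v : Fin n → ZMod 3) :
    ∃ w : ℕ → ZMod 3, v = fun j : Fin n => w j :=
  ⟨fun k => if h : k < n then v ⟨k, h⟩ else 0, by ext j; simp⟩

lemma hanoiTau_sub {n : ℕ} (u v : Fin n → ZMod 3) :
    hanoiTau (u - v) = hanoiTau u - hanoiTau v := by
  ext i
  simp only [hanoiTau, Pi.sub_apply, mul_sub, Finset.sum_sub_distrib]
  ring

lemma two_pow_ne_zero_zmod_three (k : ℕ) : (2 : ZMod 3) ^ k ≠ 0 :=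
  pow_ne_zero k (by decide)

lemma hanoiTau_eq_zero {n : ℕ} {v : Fin n → ZMod 3} (hv : hanoiTau v = 0) : v = 0 := by
  obtain ⟨w, rfl⟩ := exists_nat_extension v
  have key : ∀ i : Fin n, w i + weightedSum w i = 0 := fun i => by
    have h := congrFun hv i
    rw [hanoiTau_apply_nat] at h
    exact (mul_eq_zero.mp h).resolve_left (two_pow_ne_zero_zmod_three _)
  have hp : ∀ k < n, weightedSum w k = 0 := by
    intro k
    induction k with
    | zero => exact fun _ => weightedSum_zero w
    | succ k ih =>
      intro hk
      have h0 := ih (by omega)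
      have h1 := key ⟨k, by omega⟩
      simp only [h0, add_zero] at h1
      rw [weightedSum_succ, h0, h1]
      decide
  ext i
  have h := key i
  rwa [hp i i.isLt, add_zero] at h

/-- A vector with entries `0, …, 0, a, -a, …, -a` is sent by `τ` to one supported at the
position of `a`. -/
lemma hanoiTau_ne_zero_iff {n : ℕ} {d : Fin n → ZMod 3} {h : Fin n} (hlt : ∀ i < h, d i = 0)
    (hne : d h ≠ 0) (hgt : ∀ i, h < i → d i = -d h) (i : Fin n) :
    hanoiTau d i ≠ 0 ↔ i = h := by
  obtain ⟨w, rfl⟩ := exists_nat_extension d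
  have hpre : ∀ k ≤ h.val, weightedSum w k = 0 := by
    intro k
    induction k with
    | zero => exact fun _ => weightedSum_zero w
    | succ k ih =>
      intro hk
      have hw : w k = 0 := hlt ⟨k, by omega⟩ (Fin.lt_def.mpr hk)
      rw [weightedSum_succ, ih (by omega), hw]
      decide
  have hpost : ∀ k, h.val + 1 ≤ k → k < n → weightedSum w k = w h := by
    intro k hk
    induction k, hk using Nat.le_induction with
    | base =>
      intro _
      rw [weightedSum_succ, hpre _ le_rfl, mul_zero, zero_add]
    | succ k hk ih =>
      intro hkn
      have hw : w k = -w h := hgt ⟨k, by omega⟩ (Fin.lt_def.mpr hk)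
      rw [weightedSum_succ, ih (by omega), hw]
      ring
  rw [hanoiTau_apply_nat, mul_ne_zero_iff, and_iff_right (two_pow_ne_zero_zmod_three _)]
  rcases lt_trichotomy i h with hi | rfl | hi
  · have hw : w i = 0 := hlt i hi
    simp [hw, hpre i (Fin.lt_def.mp hi).le, hi.ne]
  · simpa [hpre i le_rfl] using hne
  · have hw : w i = -w h := hgt i hi
    simp [hw, hpost i (Fin.lt_def.mp hi) i.isLt, hi.ne']

lemma hanoiTau_const {n : ℕ} (c : ZMod 3) : hanoiTau (fun _ : Fin n => c) = fun _ => c := by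
  have key : ∀ k, 2 ^ k * (c + weightedSum (fun _ => c) k) = c := by
    intro k
    induction k with
    | zero => simp [weightedSum_zero]
    | succ k ih =>
      have h3 : (3 : ZMod 3) = 0 := by decide
      rw [weightedSum_succ, pow_succ]
      linear_combination ih + 2 ^ k * weightedSum (fun _ => c) k * h3 + 2 ^ k * c * h3
  ext i
  rw [hanoiTau_apply_nat (fun _ => c) i, key]

/-- for `n ≥ 1`, the map `τ` is injective, sends every edge of `S(n,3)` to
a pair of tuples differing in exactly one coordinate, and fixes every constant vertex. -/
theorem hanoiTau_embedding (n : ℕ) (hn : 1 ≤ n) :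
    Function.Injective (hanoiTau (n := n)) ∧
    (∀ u v : Fin n → ZMod 3, sierpAdjZ u v → (∃! i : Fin n, hanoiTau u i ≠ hanoiTau v i)) ∧
    (∀ c : ZMod 3, hanoiTau (fun _ : Fin n => c) = fun _ => c) := by
  refine ⟨fun u v huv => ?_, ?_, hanoiTau_const⟩
  · exact sub_eq_zero.mp (hanoiTau_eq_zero (by rw [hanoiTau_sub, huv, sub_self]))
  · rintro u v ⟨h, hlt, hne, hgt⟩
    have key : ∀ i, hanoiTau u i ≠ hanoiTau v i ↔ i = h := fun i => by
      rw [← sub_ne_zero, ← Pi.sub_apply, ← hanoiTau_sub]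
      refine hanoiTau_ne_zero_iff (fun i hi => ?_) ?_ (fun i hi => ?_) i
      · simp [hlt i hi]
      · simpa [sub_eq_zero] using hne
      · simp [hgt i hi]
    exact ⟨h, (key h).mpr rfl, fun i hi => (key i).mp hi⟩
end

section
/- For every integer n ≥ 1, the map τ : (Z/3Z)^n → (Z/3Z)^n defined by τ(v)_i = 2^{i−1}·(v_i + Σ_{j=1}^{i−1} 2^{i−1−j} v_j) is a graph isomorphism from the Sierpinski graph S(n,3) onto the Tower of Hanoi graph T(n): it is a bijection, and u, v are adjacent in S(n,3) if and only if τ(u), τ(v) are adjacent in T(n). -/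
/-- Adjacency in the Tower of Hanoi graph `T(n)`: positions `u v : (ZMod 3)ⁿ` are
adjacent iff they differ in exactly one coordinate `h` (disc `h` moves from peg `u_h`
to peg `v_h`) and every smaller disc `j > h` is on the third peg:
`u_j ∉ {u_h, v_h}`. -/
def hanoiAdj {n : ℕ} (u v : Fin n → ZMod 3) : Prop :=
  ∃ h : Fin n, u h ≠ v h ∧ (∀ j, j ≠ h → u j = v j) ∧
    ∀ j, h < j → u j ≠ u h ∧ u j ≠ v h

theorem two_pow_mul_eq_zero_iff_zmod_three (k : ℕ) (x : ZMod 3) : 2 ^ k * x = 0 ↔ x = 0 := by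
  have h2 : (2 : ZMod 3) ≠ 0 := by decide
  have : Fact (Nat.Prime 3) := ⟨Nat.prime_three⟩
  simp [h2]

theorem hanoiTau_sub_of_eq_below {n : ℕ} {u v : Fin n → ZMod 3} {h : Fin n}
    (huv : ∀ i, i < h → u i = v i) :
    hanoiTau u h - hanoiTau v h = 2 ^ h.val * (u h - v h) := by
  have hs : ∑ j ∈ Finset.univ.filter (· < h), (2 : ZMod 3) ^ (h.val - j.val - 1) * u j =
      ∑ j ∈ Finset.univ.filter (· < h), (2 : ZMod 3) ^ (h.val - j.val - 1) * v j :=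
    Finset.sum_congr rfl fun j hj => by rw [huv j (Finset.mem_filter.mp hj).2]
  rw [hanoiTau, hanoiTau, hs]
  ring

theorem hanoiTau_eq_iff_of_eq_below {n : ℕ} {u v : Fin n → ZMod 3} {h : Fin n}
    (huv : ∀ i, i < h → u i = v i) : hanoiTau u h = hanoiTau v h ↔ u h = v h := by
  rw [← sub_eq_zero, hanoiTau_sub_of_eq_below huv, two_pow_mul_eq_zero_iff_zmod_three, sub_eq_zero]

theorem eq_of_hanoiTau_eq_of_le {n : ℕ} {u v : Fin n → ZMod 3} (i : Fin n)
    (huv : ∀ j, j ≤ i → hanoiTau u j = hanoiTau v j) : u i = v i := by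
  induction i using WellFoundedLT.induction with
  | ind i ih =>
    exact (hanoiTau_eq_iff_of_eq_below fun j hj =>
      ih j hj fun k hk => huv k (hk.trans hj.le)).mp (huv i le_rfl)

theorem hanoiTau_eq_of_eq_of_le {n : ℕ} {u v : Fin n → ZMod 3} (i : Fin n)
    (huv : ∀ j, j ≤ i → u j = v j) : hanoiTau u i = hanoiTau v i :=
  (hanoiTau_eq_iff_of_eq_below fun j hj => huv j hj.le).mpr (huv i le_rfl)

theorem hanoiTau_injective (n : ℕ) : Function.Injective (hanoiTau (n := n)) := fun _ _ huv =>
  funext fun i => eq_of_hanoiTau_eq_of_le i fun j _ => congrFun huv j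

/-- Consecutive coordinates of `hanoiTau v` differ by a signed difference of those of `v`. -/
theorem hanoiTau_succ {n : ℕ} (v : Fin n → ZMod 3) (i : ℕ) (hi : i + 1 < n) :
    hanoiTau v ⟨i + 1, hi⟩ =
      hanoiTau v ⟨i, by omega⟩ + 2 ^ (i + 1) * (v ⟨i + 1, hi⟩ - v ⟨i, by omega⟩) := by
  have hf : Finset.univ.filter (· < (⟨i + 1, hi⟩ : Fin n)) =
      insert ⟨i, by omega⟩ (Finset.univ.filter (· < (⟨i, by omega⟩ : Fin n))) := by
    ext j
    simp [Fin.lt_def, Fin.ext_iff]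
    omega
  have hs : ∑ j ∈ Finset.univ.filter (· < (⟨i, by omega⟩ : Fin n)),
        (2 : ZMod 3) ^ (i + 1 - j.val - 1) * v j =
      2 * ∑ j ∈ Finset.univ.filter (· < (⟨i, by omega⟩ : Fin n)),
        (2 : ZMod 3) ^ (i - j.val - 1) * v j := by
    rw [Finset.mul_sum]
    refine Finset.sum_congr rfl fun j hj => ?_
    have hj' : j.val < i := (Finset.mem_filter.mp hj).2
    rw [show i + 1 - j.val - 1 = i - j.val - 1 + 1 by omega]
    ring
  have h3 : (3 : ZMod 3) = 0 := by decide
  simp only [hanoiTau]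
  rw [hf, Finset.sum_insert (by simp), hs]
  simp only [Nat.add_sub_cancel_left, Nat.sub_self, pow_zero, one_mul]
  generalize ∑ j ∈ Finset.univ.filter (· < (⟨i, by omega⟩ : Fin n)),
    (2 : ZMod 3) ^ (i - j.val - 1) * v j = s
  linear_combination (2 ^ i * (v ⟨i, by omega⟩ + s)) * h3

/-- A vector is constant after coordinate `h` iff its image under `hanoiTau` is. -/
theorem forall_gt_eq_iff_hanoiTau {n : ℕ} (u : Fin n → ZMod 3) (h : Fin n) (c : ZMod 3) :
    (∀ j, h < j → u j = c) ↔
      ∀ j, h < j → hanoiTau u j = hanoiTau u h + 2 ^ (h.val + 1) * (c - u h) := by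
  obtain ⟨h, hh⟩ := h
  constructor
  · rintro H ⟨j, hj⟩ hlt
    replace hlt : h + 1 ≤ j := hlt
    induction j, hlt using Nat.le_induction with
    | base => rw [hanoiTau_succ, H _ (Nat.lt_succ_self h)]
    | succ j hle ih =>
      rw [hanoiTau_succ, ih (by omega), H ⟨j + 1, hj⟩ (show h < j + 1 by omega),
        H ⟨j, by omega⟩ (show h < j from hle)]
      ring
  · rintro H ⟨j, hj⟩ hlt
    replace hlt : h + 1 ≤ j := hlt
    induction j, hlt using Nat.le_induction with
    | base =>
      have e := H _ (show (⟨h, hh⟩ : Fin n) < ⟨h + 1, hj⟩ from Nat.lt_succ_self h)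
      rw [hanoiTau_succ] at e
      refine sub_eq_zero.mp ((two_pow_mul_eq_zero_iff_zmod_three (h + 1) _).mp ?_)
      linear_combination e
    | succ j hle ih =>
      have e := H ⟨j + 1, hj⟩ (show h < j + 1 by omega)
      rw [hanoiTau_succ, H _ (show h < j from hle), ih (by omega)] at e
      refine sub_eq_zero.mp ((two_pow_mul_eq_zero_iff_zmod_three (j + 1) _).mp ?_)
      linear_combination e

theorem eq_neg_add_iff_ne_zmod_three :
    ∀ a b x : ZMod 3, a ≠ b → (x = -(a + b) ↔ x ≠ a ∧ x ≠ b) := by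
  decide

theorem forall_gt_eq_iff_hanoiTau_eq_neg_add {n : ℕ} {u v : Fin n → ZMod 3} {h : Fin n}
    (huv : ∀ i, i < h → u i = v i) :
    (∀ j, h < j → u j = v h) ↔
      ∀ j, h < j → hanoiTau u j = -(hanoiTau u h + hanoiTau v h) := by
  have h3 : (3 : ZMod 3) = 0 := by decide
  have e : hanoiTau u h + 2 ^ (h.val + 1) * (v h - u h) = -(hanoiTau u h + hanoiTau v h) := by
    linear_combination (hanoiTau u h + 2 ^ h.val * (v h - u h)) * h3 -
      hanoiTau_sub_of_eq_below huv
  rw [forall_gt_eq_iff_hanoiTau, e]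

theorem sierpAdjZ_iff_hanoiAdj_hanoiTau {n : ℕ} (u v : Fin n → ZMod 3) :
    sierpAdjZ u v ↔ hanoiAdj (hanoiTau u) (hanoiTau v) := by
  refine exists_congr fun h => ?_
  constructor
  · rintro ⟨hlt, hne, hgt⟩
    have hne' := mt (hanoiTau_eq_iff_of_eq_below hlt).mp hne
    have hu := (forall_gt_eq_iff_hanoiTau_eq_neg_add hlt).mp fun j hj => (hgt j hj).1
    have hv := (forall_gt_eq_iff_hanoiTau_eq_neg_add fun i hi => (hlt i hi).symm).mp
      fun j hj => (hgt j hj).2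
    refine ⟨hne', fun j hj => ?_, fun j hj =>
      (eq_neg_add_iff_ne_zmod_three _ _ _ hne').mp (hu j hj)⟩
    rcases lt_or_gt_of_ne hj with hj | hj
    · exact hanoiTau_eq_of_eq_of_le j fun k hk => hlt k (hk.trans_lt hj)
    · rw [hu j hj, hv j hj, add_comm]
  · rintro ⟨hne, heq, hgt⟩
    have hlt : ∀ i, i < h → u i = v i := fun i hi =>
      eq_of_hanoiTau_eq_of_le i fun j hj => heq j (hj.trans_lt hi).ne
    have hthird : ∀ j, h < j → hanoiTau u j = -(hanoiTau u h + hanoiTau v h) := fun j hj =>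
      (eq_neg_add_iff_ne_zmod_three _ _ _ hne).mpr (hgt j hj)
    refine ⟨hlt, mt (hanoiTau_eq_iff_of_eq_below hlt).mpr hne, fun j hj => ⟨?_, ?_⟩⟩
    · exact (forall_gt_eq_iff_hanoiTau_eq_neg_add hlt).mpr hthird j hj
    · exact (forall_gt_eq_iff_hanoiTau_eq_neg_add fun i hi => (hlt i hi).symm).mpr
        (fun k hk => by rw [← heq k hk.ne', hthird k hk, add_comm]) j hj

/-- `τ` is a graph isomorphism from `S(n,3)` onto the Tower of Hanoi
graph `T(n)`. -/
theorem hanoiTau_iso (n : ℕ) (hn : 1 ≤ n) :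
    Function.Bijective (hanoiTau (n := n)) ∧
    ∀ u v : Fin n → ZMod 3, sierpAdjZ u v ↔ hanoiAdj (hanoiTau u) (hanoiTau v) := by
  exact ⟨Finite.injective_iff_bijective.mp (hanoiTau_injective n), sierpAdjZ_iff_hanoiAdj_hanoiTau⟩
end

section
/- Let m ≥ 2 and n ≥ 2 be integers, let π_0, π_1, ..., π_{m−1} and π_m be permutations of {0,1,...,m−1} satisfying π_i(j) = π_j(i) for all i, j ∈ {0,...,m−1}, and let ε : {0,...,m−1}^{n−1} → {0,...,m−1}^{n−1} be an injective map sending every edge of S(n−1,m) to a pair of tuples differing in exactly one coordinate. Then the map ε' : {0,...,m−1}^n → {0,...,m−1}^n defined by ε'(v_1, v_2, ..., v_n) = (π_m(v_1), ε(π_{v_1}(v_2), ..., π_{v_1}(v_n))) is injective and sends every edge of S(n,m) to a pair of tuples differing in exactly one coordinate. -/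
/-- Permuting the alphabet preserves adjacency in the Sierpinski graph. -/
theorem sierpAdj.comp_injective {n m k : ℕ} {u v : Fin n → Fin m} (huv : sierpAdj u v)
    {f : Fin m → Fin k} (hf : Function.Injective f) :
    sierpAdj (fun i => f (u i)) (fun i => f (v i)) := by
  obtain ⟨h, hlt, hne, hgt⟩ := huv
  exact ⟨h, fun i hi => congrArg f (hlt i hi), hf.ne hne,
    fun j hj => ⟨congrArg f (hgt j hj).1, congrArg f (hgt j hj).2⟩⟩

/-- Tuples with a common tail and distinct heads differ in exactly one coordinate. -/
theorem existsUnique_cons_ne_of_head_ne {n : ℕ} {α : Type*} {a b : α} (hab : a ≠ b)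
    (x : Fin n → α) :
    ∃! i : Fin (n + 1), (Fin.cons a x : Fin (n + 1) → α) i ≠ (Fin.cons b x : Fin (n + 1) → α) i := by
  refine ⟨0, by simpa using hab, fun i hi => ?_⟩
  cases i using Fin.cases with
  | zero => rfl
  | succ j => simp at hi

/-- Prepending a common head preserves differing in exactly one coordinate. -/
theorem existsUnique_cons_ne_of_tail {n : ℕ} {α : Type*} (a : α) {x y : Fin n → α}
    (hxy : ∃! i, x i ≠ y i) :
    ∃! i : Fin (n + 1), (Fin.cons a x : Fin (n + 1) → α) i ≠ (Fin.cons a y : Fin (n + 1) → α) i := by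
  obtain ⟨k, hk, huniq⟩ := hxy
  refine ⟨k.succ, by simpa using hk, fun i hi => ?_⟩
  cases i using Fin.cases with
  | zero => simp at hi
  | succ j => exact congrArg Fin.succ (huniq j (by simpa using hi))

/-- if `π_0, …, π_{m−1}, π_m` are permutations of `{0,…,m−1}` with
`π_i(j) = π_j(i)`, and `ε` is an injective map sending every edge of `S(n−1,m)` to a
pair of tuples differing in exactly one coordinate, then so is the map
`ε'(v_1,…,v_n) = (π_m(v_1), ε(π_{v_1}(v_2), …, π_{v_1}(v_n)))` for `S(n,m)`.
(Here the rank is `n+1` with `n ≥ 1`, matching `n ≥ 2` in the paper.) -/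
theorem eps_recursive_embedding (n m : ℕ) (hn : 1 ≤ n) (hm : 2 ≤ m)
    (π : Fin m → Equiv.Perm (Fin m)) (πm : Equiv.Perm (Fin m))
    (hcomm : ∀ i j : Fin m, π i j = π j i)
    (ε : (Fin n → Fin m) → (Fin n → Fin m))
    (hinj : Function.Injective ε)
    (hedge : ∀ u v : Fin n → Fin m, sierpAdj u v → ∃! i : Fin n, ε u i ≠ ε v i) :
    Function.Injective
      (fun v : Fin (n + 1) → Fin m =>
        (Fin.cons (πm (v 0)) (ε fun k : Fin n => π (v 0) (v k.succ)) : Fin (n + 1) → Fin m)) ∧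
    ∀ u v : Fin (n + 1) → Fin m, sierpAdj u v →
      ∃! i : Fin (n + 1),
        (Fin.cons (πm (u 0)) (ε fun k : Fin n => π (u 0) (u k.succ)) : Fin (n + 1) → Fin m) i ≠
        (Fin.cons (πm (v 0)) (ε fun k : Fin n => π (v 0) (v k.succ)) : Fin (n + 1) → Fin m) i := by
  refine ⟨fun u v huv => ?_, fun u v huv => ?_⟩
  · obtain ⟨hhead, htail⟩ := Fin.cons_injective2 huv
    have h0 : u 0 = v 0 := πm.injective hhead
    funext i
    cases i using Fin.cases with
    | zero => exact h0
    | succ k =>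
      have hk := congrFun (hinj htail) k
      simp only [h0] at hk
      exact (π (v 0)).injective hk
  · obtain ⟨h, hlt, hne, hgt⟩ := huv
    cases h using Fin.cases with
    | zero =>
      have htail : (fun k : Fin n => π (u 0) (u k.succ)) = fun k => π (v 0) (v k.succ) := by
        funext k
        rw [(hgt k.succ k.succ_pos).1, (hgt k.succ k.succ_pos).2, hcomm]
      rw [htail]
      exact existsUnique_cons_ne_of_head_ne (πm.injective.ne hne) _
    | succ h =>
      have hadj : sierpAdj (fun k : Fin n => u k.succ) (fun k => v k.succ) :=
        ⟨h, fun i hi => hlt i.succ (Fin.succ_lt_succ_iff.mpr hi), hne,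
          fun j hj => hgt j.succ (Fin.succ_lt_succ_iff.mpr hj)⟩
      rw [hlt 0 h.succ_pos]
      exact existsUnique_cons_ne_of_tail _
        (hedge _ _ (hadj.comp_injective (π (v 0)).injective))
end

section
/- Let m ≥ 3 be odd, so 2 is invertible in Z/mZ. For every integer n ≥ 1, the map τ : (Z/mZ)^n → (Z/mZ)^n defined by τ(v)_i = 2^{−(i−1)}·v_i + Σ_{j=1}^{i−1} 2^{−j}·v_j is injective, sends every edge of the Sierpinski graph S(n,m) to a pair of tuples differing in exactly one coordinate, and fixes every constant vertex: τ(i,i,...,i) = (i,i,...,i) for each i ∈ Z/mZ. -/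
/-- The generalized Tower-of-Hanoi embedding map for odd `m`:
`τ(v)_i = 2^{−(i−1)}·v_i + Σ_{j=1}^{i−1} 2^{−j}·v_j` (0-indexed coordinates;
`2⁻¹` is the inverse of `2` in `ZMod m`). -/
def hanoiTauM {n m : ℕ} (v : Fin n → ZMod m) : Fin n → ZMod m :=
  fun i => (2 : ZMod m)⁻¹ ^ i.val * v i +
    ∑ j ∈ Finset.univ.filter (· < i), (2 : ZMod m)⁻¹ ^ (j.val + 1) * v j

theorem isUnit_two_zmod_of_odd {m : ℕ} (hodd : Odd m) : IsUnit (2 : ZMod m) := by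
  simpa using (ZMod.isUnit_iff_coprime 2 m).2 (Nat.coprime_two_left.2 hodd)

theorem hanoiTauM_zero {n m : ℕ} (h : 0 < n) (v : Fin n → ZMod m) :
    hanoiTauM v ⟨0, h⟩ = v ⟨0, h⟩ := by
  have hempty : Finset.univ.filter (· < (⟨0, h⟩ : Fin n)) = ∅ :=
    Finset.filter_eq_empty_iff.2 fun j _ => Nat.not_lt_zero j
  simp [hanoiTauM, hempty]

theorem hanoiTauM_succ {n m : ℕ} (hodd : Odd m) (v : Fin n → ZMod m) (k : ℕ) (hk : k + 1 < n) :
    hanoiTauM v ⟨k + 1, hk⟩ = hanoiTauM v ⟨k, k.lt_succ_self.trans hk⟩ +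
      (2 : ZMod m)⁻¹ ^ (k + 1) * (v ⟨k + 1, hk⟩ - v ⟨k, k.lt_succ_self.trans hk⟩) := by
  have h2 : (2 : ZMod m) * 2⁻¹ = 1 := ZMod.mul_inv_of_unit _ (isUnit_two_zmod_of_odd hodd)
  have hset : Finset.univ.filter (· < (⟨k + 1, hk⟩ : Fin n)) =
      insert ⟨k, k.lt_succ_self.trans hk⟩
        (Finset.univ.filter (· < (⟨k, k.lt_succ_self.trans hk⟩ : Fin n))) := by
    ext j
    simp only [Finset.mem_filter, Finset.mem_univ, true_and, Finset.mem_insert, Fin.lt_def,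
      Fin.ext_iff]
    omega
  simp only [hanoiTauM, hset]
  rw [Finset.sum_insert (by simp)]
  linear_combination (2 : ZMod m)⁻¹ ^ k * v ⟨k, k.lt_succ_self.trans hk⟩ * h2

theorem hanoiTauM_injective {n m : ℕ} (hodd : Odd m) :
    Function.Injective (hanoiTauM (n := n) (m := m)) := by
  have h2 : (2 : ZMod m) * 2⁻¹ = 1 := ZMod.mul_inv_of_unit _ (isUnit_two_zmod_of_odd hodd)
  have hu : IsUnit (2 : ZMod m)⁻¹ := .of_mul_eq_one_right _ h2
  intro u v huv
  ext ⟨k, hk⟩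
  induction k with
  | zero => simpa only [hanoiTauM_zero] using congrFun huv ⟨0, hk⟩
  | succ k ih =>
    have h := congrFun huv ⟨k + 1, hk⟩
    rw [hanoiTauM_succ hodd, hanoiTauM_succ hodd, huv, ih] at h
    exact sub_left_injective ((hu.pow (k + 1)).mul_left_cancel (add_left_cancel h))

theorem hanoiTauM_const {n m : ℕ} (hodd : Odd m) (c : ZMod m) :
    hanoiTauM (fun _ : Fin n => c) = fun _ => c := by
  ext ⟨k, hk⟩
  induction k with
  | zero => exact hanoiTauM_zero hk _
  | succ k ih => simp [hanoiTauM_succ hodd, ih]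

theorem hanoiTauM_sub_of_eq_below {n m : ℕ} {u v : Fin n → ZMod m} {h : Fin n}
    (huv : ∀ i, i < h → u i = v i) :
    hanoiTauM u h - hanoiTauM v h = (2 : ZMod m)⁻¹ ^ h.val * (u h - v h) := by
  have hsum : ∑ j ∈ Finset.univ.filter (· < h), (2 : ZMod m)⁻¹ ^ (j.val + 1) * u j =
      ∑ j ∈ Finset.univ.filter (· < h), (2 : ZMod m)⁻¹ ^ (j.val + 1) * v j :=
    Finset.sum_congr rfl fun j hj => by rw [huv j (Finset.mem_filter.1 hj).2]
  simp only [hanoiTauM, hsum]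
  ring

theorem hanoiTauM_eq_of_swap_above {n m : ℕ} (hodd : Odd m) {u v : Fin n → ZMod m} {h : Fin n}
    (hlt : ∀ i, i < h → u i = v i) (hgt : ∀ j, h < j → u j = v h ∧ v j = u h)
    {i : Fin n} (hi : h < i) : hanoiTauM u i = hanoiTauM v i := by
  have h2 : (2 : ZMod m) * 2⁻¹ = 1 := ZMod.mul_inv_of_unit _ (isUnit_two_zmod_of_odd hodd)
  obtain ⟨k, hk⟩ := i
  obtain ⟨a, ha⟩ := h
  replace hi : a + 1 ≤ k := hi
  induction k, hi using Nat.le_induction with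
  | base =>
    obtain ⟨h3, h4⟩ := hgt ⟨a + 1, hk⟩ a.lt_succ_self
    have h5 := hanoiTauM_sub_of_eq_below hlt
    rw [hanoiTauM_succ hodd, hanoiTauM_succ hodd, h3, h4]
    linear_combination h5 - (2 : ZMod m)⁻¹ ^ a * (u ⟨a, ha⟩ - v ⟨a, ha⟩) * h2
  | succ k hak ih =>
    obtain ⟨h3, h4⟩ := hgt ⟨k + 1, hk⟩ (Nat.lt_succ_of_lt hak)
    obtain ⟨h5, h6⟩ := hgt ⟨k, k.lt_succ_self.trans hk⟩ hak
    rw [hanoiTauM_succ hodd, hanoiTauM_succ hodd, h3, h4, h5, h6, ih]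
    simp

theorem existsUnique_hanoiTauM_ne {n m : ℕ} (hodd : Odd m) {u v : Fin n → ZMod m}
    (huv : sierpAdjZ u v) : ∃! i : Fin n, hanoiTauM u i ≠ hanoiTauM v i := by
  have h2 : (2 : ZMod m) * 2⁻¹ = 1 := ZMod.mul_inv_of_unit _ (isUnit_two_zmod_of_odd hodd)
  have hu : IsUnit (2 : ZMod m)⁻¹ := .of_mul_eq_one_right _ h2
  obtain ⟨h, hlt, hne, hgt⟩ := huv
  refine ⟨h, fun heq => hne ?_, fun i hi => ?_⟩
  · have h3 := hanoiTauM_sub_of_eq_below hlt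
    rw [heq, sub_self, eq_comm, (hu.pow _).mul_right_eq_zero] at h3
    exact sub_eq_zero.1 h3
  · rcases lt_trichotomy i h with hih | hih | hih
    · refine absurd (sub_eq_zero.1 ?_) hi
      rw [hanoiTauM_sub_of_eq_below fun j hj => hlt j (hj.trans hih), hlt i hih, sub_self,
        mul_zero]
    · exact hih
    · exact absurd (hanoiTauM_eq_of_swap_above hodd hlt hgt hih) hi

/-- for odd `m ≥ 3` and `n ≥ 1`, the map `τ` is injective, sends every
edge of `S(n,m)` to a pair of tuples differing in exactly one coordinate, and fixes
every constant vertex. -/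
theorem hanoiTauM_embedding (n m : ℕ) (hn : 1 ≤ n) (hm : 3 ≤ m) (hodd : Odd m) :
    Function.Injective (hanoiTauM (n := n) (m := m)) ∧
    (∀ u v : Fin n → ZMod m, sierpAdjZ u v →
      (∃! i : Fin n, hanoiTauM u i ≠ hanoiTauM v i)) ∧
    (∀ c : ZMod m, hanoiTauM (fun _ : Fin n => c) = fun _ => c) := by
  exact ⟨hanoiTauM_injective hodd, fun _ _ => existsUnique_hanoiTauM_ne hodd,
    hanoiTauM_const hodd⟩
end

section
/- For every even integer m > 2, there is no injective map f : {0,...,m−1}^2 → {0,...,m−1}^2 that sends every edge of the Sierpinski graph S(2,m) to a pair of tuples differing in exactly one coordinate and that sends each corner (i,i) to a constant pair, i.e., f(i,i) = (c_i, c_i) for some c_i, for every i ∈ {0,...,m−1}. -/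
/-- A family of pairs, any two of which differ in exactly one coordinate, is constant in one
of the two coordinates. -/
theorem exists_constant_coordinate {ι α : Type*} (x : ι → Fin 2 → α)
    (hx : ∀ b b', b ≠ b' → ∃! i, x b i ≠ x b' i) : ∃ i, ∀ b b', x b i = x b' i := by
  have hor : ∀ b b', x b 0 = x b' 0 ∨ x b 1 = x b' 1 := by
    intro b b'
    by_contra! h
    have hb : b ≠ b' := fun hb => h.1 (by rw [hb])
    exact absurd ((hx b b' hb).unique h.1 h.2) (by decide)
  by_contra! hcon
  obtain ⟨a, b, hab⟩ := hcon 0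
  obtain ⟨c, d, hcd⟩ := hcon 1
  grind only [hor a b, hor a c, hor a d, hor b c, hor b d, hor c d]

/-- An involution of a finite type with a unique fixed point forces odd cardinality. -/
theorem not_even_card_of_involutive_of_unique_fixed {α : Type*} [Fintype α] [DecidableEq α]
    (σ : α → α) (hσ : Function.Involutive σ) (a : α) (ha : ∀ b, σ b = b ↔ b = a) :
    ¬ Even (Fintype.card α) := by
  intro heven
  have hmod := Equiv.Perm.card_fixedPoints_modEq (f := σ) (p := 2) (n := 1)
    (funext hσ)
  have hone : Fintype.card (Function.fixedPoints σ) = 1 :=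
    Fintype.card_eq_one_iff.2 ⟨⟨a, (ha a).2 rfl⟩, fun b => Subtype.ext ((ha b).1 b.2)⟩
  rw [hone] at hmod
  have := Nat.even_iff.1 heven
  unfold Nat.ModEq at hmod
  omega

/-- A symmetric square of even order whose rows are bijective (a symmetric Latin square) cannot
have pairwise distinct diagonal entries. -/
theorem not_injective_diagonal_of_symmetric_latin {α β : Type*} [Fintype α] [Nonempty α]
    (heven : Even (Fintype.card α)) (L : α → α → β) (hrow : ∀ a, Function.Bijective (L a))
    (hsymm : ∀ a b, L a b = L b a) : ¬ Function.Injective fun a => L a a := by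
  classical
  intro hdiag
  obtain ⟨a₀⟩ := ‹Nonempty α›
  choose σ hσ using fun a => (hrow a).2 (L a₀ a₀)
  refine not_even_card_of_involutive_of_unique_fixed σ (fun a => ?_) a₀ (fun b => ?_) heven
  · apply (hrow (σ a)).1
    rw [hσ (σ a), hsymm (σ a) a, hσ a]
  · constructor
    · intro hb
      apply hdiag
      have := hσ b
      rwa [hb] at this
    · rintro rfl
      exact (hrow b).1 (hσ b)

/-- for every even `m > 2`, there is no injective map
`f : {0,…,m−1}² → {0,…,m−1}²` sending every edge of `S(2,m)` to a pair of tuples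
differing in exactly one coordinate and sending each corner `(i,i)` to a constant
pair `(c_i, c_i)`. -/
theorem no_constant_corner_embedding (m : ℕ) (hm : 2 < m) (heven : Even m) :
    ¬ ∃ f : (Fin 2 → Fin m) → (Fin 2 → Fin m),
        Function.Injective f ∧
        (∀ u v : Fin 2 → Fin m, sierpAdj u v → (∃! i : Fin 2, f u i ≠ f v i)) ∧
        (∀ i : Fin m, ∃ c : Fin m, f (fun _ => i) = fun _ => c) := by
  rintro ⟨f, hinj, hadj, hcorner⟩
  have hclique : ∀ a b b' : Fin m, b ≠ b' → ∃! i, f ![a, b] i ≠ f ![a, b'] i := by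
    intro a b b' hb
    refine hadj _ _ ⟨1, fun i hi => ?_, by simpa using hb, fun j hj => ?_⟩
    · obtain rfl : i = 0 := by omega
      rfl
    · omega
  have hcross : ∀ a b : Fin m, a ≠ b → ∃! i, f ![a, b] i ≠ f ![b, a] i := by
    intro a b hab
    refine hadj _ _ ⟨0, fun i hi => ?_, by simpa using hab, fun j hj => ?_⟩
    · exact absurd hi (Fin.not_lt_zero i)
    · obtain rfl : j = 1 := by omega
      simp
  have hpair : ∀ a b a' b' : Fin m, ∀ i j : Fin 2, i ≠ j → f ![a, b] i = f ![a', b'] i →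
      f ![a, b] j = f ![a', b'] j → a = a' ∧ b = b' := by
    intro a b a' b' i j hij hi hj
    have heq : ![a, b] = ![a', b'] := by
      apply hinj
      funext k
      obtain rfl | rfl : k = i ∨ k = j := by omega
      · exact hi
      · exact hj
    exact ⟨by simpa using congrFun heq 0, by simpa using congrFun heq 1⟩
  choose d hd using fun a => exists_constant_coordinate (fun b => f ![a, b]) (hclique a)
  have hbij : ∀ a j, d a ≠ j → Function.Bijective fun b => f ![a, b] j := by
    intro a j hj
    refine Finite.injective_iff_bijective.1 fun b b' hb => ?_
    exact (hpair a b a b' (d a) j hj (hd a b b') hb).2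
  have hd_const : ∀ a a', d a = d a' := by
    intro a a'
    by_contra hne
    obtain ⟨b, hb⟩ := (hbij a (d a') hne).2 (f ![a', a'] (d a'))
    obtain ⟨b', hb'⟩ := (hbij a' (d a) (Ne.symm hne)).2 (f ![a, a] (d a))
    have := (hpair a b a' b' (d a) (d a') hne ((hd a b a).trans hb'.symm)
      (hb.trans (hd a' a' b'))).1
    exact hne (congrArg d this)
  have : Nonempty (Fin m) := ⟨⟨0, by omega⟩⟩
  obtain ⟨j, hj⟩ : ∃ j, ∀ a, d a ≠ j := by
    obtain ⟨a₀⟩ := this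
    obtain ⟨j, hj⟩ := exists_ne (d a₀)
    exact ⟨j, fun a => hd_const a a₀ ▸ hj.symm⟩
  refine not_injective_diagonal_of_symmetric_latin (by simpa using heven)
    (fun a b => f ![a, b] j) (fun a => hbij a j (hj a)) (fun a b => ?_) (fun a b hab => ?_)
  · by_cases hab : a = b
    · rw [hab]
    by_contra hne
    have hline : f ![a, b] (d a) = f ![b, a] (d a) := by
      by_contra hne'
      exact hj a ((hcross a b hab).unique hne' hne)
    obtain ⟨b', hb'⟩ := (hbij a j (hj a)).2 (f ![b, a] j)
    exact hab (hpair a b' b a (d a) j (hj a) ((hd a b' b).trans hline) hb').1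
  · have hconst : ∀ c : Fin m, ![c, c] = fun _ => c := by
      intro c
      funext k
      fin_cases k <;> rfl
    obtain ⟨c, hc⟩ := hcorner a
    obtain ⟨c', hc'⟩ := hcorner b
    simp only [hconst, hc, hc'] at hab
    exact congrFun (hinj (hc.trans (hab ▸ hc'.symm))) 0
end

section
/- For all integers n ≥ 1 and m ≥ 2, if u, v, w are three pairwise-adjacent vertices of the Sierpinski graph S(n,m), then u_i = v_i = w_i for every i ∈ {1,...,n−1}; i.e., every triangle of S(n,m) is contained in one of the m^{n−1} complete subgraphs induced by the vertices agreeing in all but the last coordinate. -/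
/-- `h` is the position witnessing that `u` and `v` are adjacent in `S(n,m)`. -/
def SierpAdjAt {n m : ℕ} (u v : Fin n → Fin m) (h : Fin n) : Prop :=
  (∀ i, i < h → u i = v i) ∧ u h ≠ v h ∧ ∀ j, h < j → u j = v h ∧ v j = u h

theorem SierpAdjAt.symm {n m : ℕ} {u v : Fin n → Fin m} {h : Fin n} (H : SierpAdjAt u v h) :
    SierpAdjAt v u h :=
  ⟨fun i hi => (H.1 i hi).symm, H.2.1.symm, fun j hj => (H.2.2 j hj).symm⟩

/-- In a triangle, no edge at a vertex branches strictly before the other edge there. -/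
theorem SierpAdjAt.le_of_triangle {n m : ℕ} {u v w : Fin n → Fin m} {a b c : Fin n}
    (huv : SierpAdjAt u v a) (huw : SierpAdjAt u w b) (hvw : SierpAdjAt v w c) : b ≤ a := by
  by_contra! hab
  have hva : v a ≠ w a := fun h => huv.2.1 ((huw.1 a hab).trans h.symm)
  rcases lt_trichotomy c a with hca | rfl | hac
  · exact hvw.2.1 ((huv.1 c hca).symm.trans (huw.1 c (hca.trans hab)))
  · exact huw.2.1 ((huv.2.2 b hab).1.trans (hvw.2.2 b hab).2.symm)
  · exact hva (hvw.1 a hac)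

/-- for `n ≥ 1`, `m ≥ 2`, any three pairwise adjacent vertices `u, v, w`
of `S(n,m)` agree in every coordinate except possibly the last: every triangle is
contained in one of the complete subgraphs induced by the vertices agreeing in all
but the last coordinate. -/
theorem sierp_triangles_in_Km (n m : ℕ) (hn : 1 ≤ n) (hm : 2 ≤ m)
    (u v w : Fin n → Fin m)
    (huv : sierpAdj u v) (huw : sierpAdj u w) (hvw : sierpAdj v w) :
    ∀ i : Fin n, i.val < n - 1 → u i = v i ∧ v i = w i := by
  obtain ⟨a, ha : SierpAdjAt u v a⟩ := huv
  obtain ⟨b, hb : SierpAdjAt u w b⟩ := huw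
  obtain ⟨c, hc : SierpAdjAt v w c⟩ := hvw
  obtain rfl : a = b := le_antisymm (hb.le_of_triangle ha hc.symm) (ha.le_of_triangle hb hc)
  obtain rfl : a = c :=
    le_antisymm (hc.le_of_triangle ha.symm hb.symm) (ha.symm.le_of_triangle hc hb)
  have hlast : ∀ j, ¬ a < j := fun j hj =>
    hc.2.1 ((ha.2.2 j hj).1.symm.trans (hb.2.2 j hj).1)
  intro i hi
  have hia : i < a := by
    have h := hlast ⟨n - 1, by omega⟩
    simp only [Fin.lt_def] at h ⊢
    omega
  exact ⟨ha.1 i hia, hc.1 i hia⟩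
end
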